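/- Define the Wilson polynomial W_n(x^2; a,b,c,d) as above. Then (x^2 + d^2) W_n(x^2; a,b,c,d+1) = ((n+a+d)(n+b+d)(n+c+d)/(2n+a+b+c+d)) W_n(x^2; a,b,c,d) - (1/(2n+a+b+c+d)) W_{n+1}(x^2; a,b,c,d). -/

import Mathlib

open Finset Complex

noncomputable def poch (a : ℂ) (k : ℕ) : ℂ := (ascPochhammer ℂ k).eval a

/-- Wilson polynomial `W_n(x²; a,b,c,d)` as a function of `x`, as the terminating ₄F₃ sum
times `(a+b)_n (a+c)_n (a+d)_n`. -/
noncomputable def wilson (n : ℕ) (x a b c d : ℂ) : ℂ :=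
  poch (a + b) n * poch (a + c) n * poch (a + d) n *
    ∑ k ∈ range (n + 1),
      poch (-(n : ℂ)) k * poch ((n : ℂ) + a + b + c + d - 1) k * poch (a + I * x) k *
          poch (a - I * x) k /
        (poch (a + b) k * poch (a + c) k * poch (a + d) k * (k.factorial : ℂ))

theorem poch_zero (a : ℂ) : poch a 0 = 1 := by simp [poch]

theorem poch_succ (a : ℂ) (k : ℕ) : poch a (k + 1) = poch a k * (a + k) := by
  simp [poch, ascPochhammer_succ_right]

theorem poch_succ_left (a : ℂ) (k : ℕ) : poch a (k + 1) = a * poch (a + 1) k := by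
  simp [poch, ascPochhammer_succ_left]

theorem poch_neg_natCast_succ (n : ℕ) : poch (-(n : ℂ)) (n + 1) = 0 := by
  simp [poch_succ]

/-- The coefficient of `(a + ix)_k (a - ix)_k` in the Wilson polynomial. -/
noncomputable def wilsonCoeff (n : ℕ) (a b c d : ℂ) (k : ℕ) : ℂ :=
  poch (a + b) n * poch (a + c) n * poch (a + d) n *
    (poch (-(n : ℂ)) k * poch ((n : ℂ) + a + b + c + d - 1) k /
      (poch (a + b) k * poch (a + c) k * poch (a + d) k * (k.factorial : ℂ)))

theorem wilson_eq_sum_wilsonCoeff (n : ℕ) (x a b c d : ℂ) :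
    wilson n x a b c d =
      ∑ k ∈ range (n + 1),
        wilsonCoeff n a b c d k * (poch (a + I * x) k * poch (a - I * x) k) := by
  rw [wilson, mul_sum]
  refine sum_congr rfl fun k _ => ?_
  rw [wilsonCoeff]
  ring

theorem wilsonCoeff_self_succ (n : ℕ) (a b c d : ℂ) : wilsonCoeff n a b c d (n + 1) = 0 := by
  simp [wilsonCoeff, poch_neg_natCast_succ]

theorem poch_mul_poch_succ (a x : ℂ) (k : ℕ) :
    poch (a + I * x) (k + 1) * poch (a - I * x) (k + 1) =
      poch (a + I * x) k * poch (a - I * x) k * ((a + k) ^ 2 + x ^ 2) := by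
  rw [poch_succ, poch_succ]
  linear_combination (-(poch (a + I * x) k * poch (a - I * x) k) * x ^ 2) * I_sq

theorem poch_add_one_eq_div {a : ℂ} (ha : a ≠ 0) (k : ℕ) :
    poch (a + 1) k = poch a k * (a + k) / a := by
  rw [eq_div_iff ha, mul_comm, ← poch_succ_left, poch_succ]

theorem wilsonCoeff_recurrence_zero (n : ℕ) (a b c d : ℂ) :
    (2 * (n : ℂ) + a + b + c + d) * ((d ^ 2 - a ^ 2) * wilsonCoeff n a b c (d + 1) 0) =
      ((n : ℂ) + a + d) * ((n : ℂ) + b + d) * ((n : ℂ) + c + d) * wilsonCoeff n a b c d 0 -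
        wilsonCoeff (n + 1) a b c d 0 := by
  have h : (a + d) * poch (a + d + 1) n = poch (a + d) n * (a + d + n) := by
    rw [← poch_succ_left, poch_succ]
  simp only [wilsonCoeff, poch_zero, poch_succ, Nat.factorial_zero, Nat.cast_one, mul_one,
    div_one, ← add_assoc]
  linear_combination
    ((2 * (n : ℂ) + a + b + c + d) * (d - a) * poch (a + b) n * poch (a + c) n) * h

theorem wilsonCoeff_recurrence_succ (n k : ℕ) (a b c d : ℂ)
    (h1 : poch (a + b) (k + 1) ≠ 0) (h2 : poch (a + c) (k + 1) ≠ 0)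
    (h3 : poch (a + d) (k + 1) ≠ 0) (h4 : poch (a + d + 1) (k + 1) ≠ 0) :
    (2 * (n : ℂ) + a + b + c + d) *
        (wilsonCoeff n a b c (d + 1) k +
          (d ^ 2 - (a + (k + 1)) ^ 2) * wilsonCoeff n a b c (d + 1) (k + 1)) =
      ((n : ℂ) + a + d) * ((n : ℂ) + b + d) * ((n : ℂ) + c + d) *
          wilsonCoeff n a b c d (k + 1) -
        wilsonCoeff (n + 1) a b c d (k + 1) := by
  have had : a + d ≠ 0 := by
    rw [poch_succ_left] at h3
    exact left_ne_zero_of_mul h3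
  have hneg : poch (-((n : ℂ) + 1)) (k + 1) = -((n : ℂ) + 1) * poch (-(n : ℂ)) k := by
    rw [poch_succ_left]
    ring_nf
  have hsub : poch ((n : ℂ) + a + b + c + d - 1) (k + 1) =
      ((n : ℂ) + a + b + c + d - 1) * poch ((n : ℂ) + a + b + c + d) k := by
    rw [poch_succ_left, sub_add_cancel]
  have hshift : (n : ℂ) + a + b + c + (d + 1) - 1 = n + a + b + c + d := by ring
  have hshift' : (n : ℂ) + 1 + a + b + c + d - 1 = n + a + b + c + d := by ring
  rw [poch_succ] at h1 h2 h3 h4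
  obtain ⟨hb, hb'⟩ := mul_ne_zero_iff.mp h1
  obtain ⟨hc, hc'⟩ := mul_ne_zero_iff.mp h2
  obtain ⟨hd, hd'⟩ := mul_ne_zero_iff.mp h3
  have hd'' := right_ne_zero_of_mul h4
  have hk : (k.factorial : ℂ) ≠ 0 := Nat.cast_ne_zero.mpr k.factorial_ne_zero
  have hk' : (k : ℂ) + 1 ≠ 0 := Nat.cast_add_one_ne_zero k
  simp only [wilsonCoeff, Nat.cast_add, Nat.cast_one, ← add_assoc a d 1, hshift, hshift', hneg,
    hsub]
  simp only [poch_succ, poch_add_one_eq_div had, Nat.factorial_succ, Nat.cast_mul, Nat.cast_add,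
    Nat.cast_one]
  field_simp
  ring

theorem wilson_recurrence_2 (n : ℕ) (x a b c d : ℂ)
    (hden : 2 * (n : ℂ) + a + b + c + d ≠ 0)
    (h1 : ∀ k ≤ n + 1, poch (a + b) k ≠ 0) (h2 : ∀ k ≤ n + 1, poch (a + c) k ≠ 0)
    (h3 : ∀ k ≤ n + 1, poch (a + d) k ≠ 0) (h4 : ∀ k ≤ n + 1, poch (a + d + 1) k ≠ 0) :
    (x ^ 2 + d ^ 2) * wilson n x a b c (d + 1) =
      ((n : ℂ) + a + d) * ((n : ℂ) + b + d) * ((n : ℂ) + c + d) /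
          (2 * (n : ℂ) + a + b + c + d) * wilson n x a b c d -
        1 / (2 * (n : ℂ) + a + b + c + d) * wilson (n + 1) x a b c d := by
  set A : ℕ → ℂ := fun k => poch (a + I * x) k * poch (a - I * x) k with hA
  have hext (d' : ℂ) : wilson n x a b c d' =
      ∑ k ∈ range (n + 2), wilsonCoeff n a b c d' k * A k := by
    rw [wilson_eq_sum_wilsonCoeff, sum_range_succ _ (n + 1), wilsonCoeff_self_succ, zero_mul,
      add_zero]
  have hlhs : (x ^ 2 + d ^ 2) * wilson n x a b c (d + 1) =
      ∑ k ∈ range (n + 1), wilsonCoeff n a b c (d + 1) k * A (k + 1) +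
        ∑ k ∈ range (n + 2), (d ^ 2 - (a + k) ^ 2) * wilsonCoeff n a b c (d + 1) k * A k := by
    rw [sum_range_succ _ (n + 1), wilsonCoeff_self_succ, mul_zero, zero_mul, add_zero,
      ← sum_add_distrib, wilson_eq_sum_wilsonCoeff, mul_sum]
    refine sum_congr rfl fun k _ => ?_
    simp only [hA, poch_mul_poch_succ]
    ring
  have key : (2 * (n : ℂ) + a + b + c + d) * ((x ^ 2 + d ^ 2) * wilson n x a b c (d + 1)) =
      ((n : ℂ) + a + d) * ((n : ℂ) + b + d) * ((n : ℂ) + c + d) * wilson n x a b c d -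
        wilson (n + 1) x a b c d := by
    rw [hlhs, hext d, wilson_eq_sum_wilsonCoeff (n + 1), mul_sum, ← sum_sub_distrib,
      sum_range_succ' _ (n + 1), sum_range_succ' _ (n + 1), ← add_assoc, ← sum_add_distrib,
      mul_add, mul_sum]
    congr 1
    · refine sum_congr rfl fun k hk => ?_
      have hk' : k + 1 ≤ n + 1 := mem_range.mp hk
      have h := wilsonCoeff_recurrence_succ n k a b c d (h1 _ hk') (h2 _ hk') (h3 _ hk') (h4 _ hk')
      push_cast
      linear_combination A (k + 1) * h
    · push_cast
      linear_combination A 0 * wilsonCoeff_recurrence_zero n a b c d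
  rw [div_mul_eq_mul_div, one_div_mul_eq_div, ← sub_div, eq_div_iff hden, mul_comm, key]
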